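/- Let b ∈ ℝ. If b ≤ 0 set L₀ = +∞, and if b > 0 there exists L₀ > 0, such that in both cases the following holds for every L ∈ (0, L₀): given continuously differentiable, bounded, nonnegative functions a₁, a₂ : ℝ × [0,L] → ℝ and a continuous, bounded, nonnegative function a₀ : ℝ × [0,L] → ℝ, there exist α₀ > 0, ε₀ > 0 and β > 0 such that for every α ∈ (0, α₀], every T > 0 and every infinitely differentiable function u : [0,T] × ℝ × [0,L] → ℝ that vanishes whenever |x| ≥ R for some R > 0, satisfies u(t,x,0) = u(t,x,L) = 0 for all t, x, satisfies pointwise the generalized Zakharov–Kuznetsov equation u_t + b u_x + u_xxx + u_xyy + u u_x − (a₁ u_x)_x − (a₂ u_y)_y + a₀ u = 0, and whose initial datum obeys (∬_Σ u²(0,x,y) dx dy)^{1/2} ≤ ε₀, one has for all t ∈ [0,T]: ∬_Σ e^{2αx} u²(t,x,y) dx dy ≤ e^{−2αβ t} ∬_Σ e^{2αx} u²(0,x,y) dx dy. -/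

import Mathlib

open MeasureTheory Real Set

noncomputable section

/-- Partial derivative in the time variable. -/
def Dt (u : ℝ → ℝ → ℝ → ℝ) (t x y : ℝ) : ℝ := deriv (fun s => u s x y) t

/-- Partial derivative in `x`. -/
def Dx (u : ℝ → ℝ → ℝ → ℝ) (t x y : ℝ) : ℝ := deriv (fun s => u t s y) x

/-- Partial derivative in `y`. -/
def Dy (u : ℝ → ℝ → ℝ → ℝ) (t x y : ℝ) : ℝ := deriv (fun s => u t x s) y

theorem hasDerivAt_intervalIntegral_of_continuous {F F' : ℝ → ℝ → ℝ} (a b : ℝ)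
    (hF : Continuous fun p : ℝ × ℝ => F p.1 p.2)
    (hF' : Continuous fun p : ℝ × ℝ => F' p.1 p.2)
    (h : ∀ s x, HasDerivAt (fun r => F r x) (F' s x) s) (s : ℝ) :
    HasDerivAt (fun r => ∫ x in a..b, F r x) (∫ x in a..b, F' s x) s := by
  obtain ⟨C, hC⟩ := ((isCompact_Icc (a := s - 1) (b := s + 1)).prod
    (isCompact_uIcc (a := a) (b := b))).exists_bound_of_continuousOn hF'.continuousOn
  refine (intervalIntegral.hasDerivAt_integral_of_dominated_loc_of_deriv_le
    (F := F) (F' := F') (bound := fun _ => C)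
    (Icc_mem_nhds (sub_one_lt s) (lt_add_one s)) ?_ ?_ ?_ ?_ ?_ ?_).2
  · exact Filter.Eventually.of_forall fun r =>
      (show Continuous (F r) by fun_prop).aestronglyMeasurable
  · exact (show Continuous (F s) by fun_prop).intervalIntegrable _ _
  · exact (show Continuous (F' s) by fun_prop).aestronglyMeasurable
  · exact Filter.Eventually.of_forall fun x hx r hr => hC (r, x) ⟨hr, uIoc_subset_uIcc hx⟩
  · exact intervalIntegrable_const
  · exact Filter.Eventually.of_forall fun x _ r _ => h r x

/-- Iterated integral of `F` over the rectangle `[-R, R] × [0, L]`. -/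
def rectIntegral (R L : ℝ) (F : ℝ → ℝ → ℝ) : ℝ := ∫ x in (-R)..R, ∫ y in (0:ℝ)..L, F x y

theorem continuous_integral_right {F : ℝ → ℝ → ℝ} (a b : ℝ)
    (hF : Continuous fun p : ℝ × ℝ => F p.1 p.2) : Continuous fun x => ∫ y in a..b, F x y :=
  intervalIntegral.continuous_parametric_intervalIntegral_of_continuous' hF a b

theorem rectIntegral_add {R L : ℝ} {F G : ℝ → ℝ → ℝ}
    (hF : Continuous fun p : ℝ × ℝ => F p.1 p.2) (hG : Continuous fun p : ℝ × ℝ => G p.1 p.2) :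
    rectIntegral R L (fun x y => F x y + G x y) = rectIntegral R L F + rectIntegral R L G := by
  unfold rectIntegral
  rw [← intervalIntegral.integral_add
    ((continuous_integral_right 0 L hF).intervalIntegrable _ _)
    ((continuous_integral_right 0 L hG).intervalIntegrable _ _)]
  refine intervalIntegral.integral_congr fun x _ => ?_
  exact intervalIntegral.integral_add
    ((show Continuous (F x) by fun_prop).intervalIntegrable _ _)
    ((show Continuous (G x) by fun_prop).intervalIntegrable _ _)

theorem rectIntegral_const_mul {R L : ℝ} (c : ℝ) (F : ℝ → ℝ → ℝ) :
    rectIntegral R L (fun x y => c * F x y) = c * rectIntegral R L F := by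
  simp only [rectIntegral, intervalIntegral.integral_const_mul]

theorem rectIntegral_mono {R L : ℝ} {F G : ℝ → ℝ → ℝ} (hR : 0 ≤ R) (hL : 0 ≤ L)
    (hF : Continuous fun p : ℝ × ℝ => F p.1 p.2) (hG : Continuous fun p : ℝ × ℝ => G p.1 p.2)
    (h : ∀ x, ∀ y ∈ Icc 0 L, F x y ≤ G x y) : rectIntegral R L F ≤ rectIntegral R L G := by
  refine intervalIntegral.integral_mono_on (by linarith)
    ((continuous_integral_right 0 L hF).intervalIntegrable _ _)
    ((continuous_integral_right 0 L hG).intervalIntegrable _ _) fun x _ => ?_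
  exact intervalIntegral.integral_mono_on hL
    ((show Continuous (F x) by fun_prop).intervalIntegrable _ _)
    ((show Continuous (G x) by fun_prop).intervalIntegrable _ _) (h x)

theorem rectIntegral_nonneg {R L : ℝ} {F : ℝ → ℝ → ℝ} (hR : 0 ≤ R) (hL : 0 ≤ L)
    (h : ∀ x, ∀ y ∈ Icc 0 L, 0 ≤ F x y) : 0 ≤ rectIntegral R L F :=
  intervalIntegral.integral_nonneg (by linarith) fun x _ =>
    intervalIntegral.integral_nonneg hL (h x)

theorem rectIntegral_deriv_fst_eq_zero {R L : ℝ} {G G' : ℝ → ℝ → ℝ}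
    (hG : Continuous fun p : ℝ × ℝ => G p.1 p.2) (hG' : Continuous fun p : ℝ × ℝ => G' p.1 p.2)
    (h : ∀ x y, HasDerivAt (fun s => G s y) (G' x y) x)
    (hl : ∀ y, G (-R) y = 0) (hr : ∀ y, G R y = 0) : rectIntegral R L G' = 0 := by
  unfold rectIntegral
  rw [intervalIntegral.integral_eq_sub_of_hasDerivAt
    (fun x _ => hasDerivAt_intervalIntegral_of_continuous 0 L hG hG' h x)
    ((continuous_integral_right 0 L hG').intervalIntegrable _ _)]
  simp [hl, hr]

theorem rectIntegral_deriv_snd_eq_zero {R L : ℝ} {G G' : ℝ → ℝ → ℝ}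
    (hG' : Continuous fun p : ℝ × ℝ => G' p.1 p.2)
    (h : ∀ x y, HasDerivAt (fun s => G x s) (G' x y) y)
    (hl : ∀ x, G x 0 = 0) (hr : ∀ x, G x L = 0) : rectIntegral R L G' = 0 := by
  have key : ∀ x, ∫ y in (0:ℝ)..L, G' x y = 0 := fun x => by
    rw [intervalIntegral.integral_eq_sub_of_hasDerivAt (fun y _ => h x y)
      ((show Continuous (G' x) by fun_prop).intervalIntegrable _ _), hl, hr, sub_zero]
  simp [rectIntegral, key]

theorem hasDerivAt_rectIntegral {R L : ℝ} {F F' : ℝ → ℝ → ℝ → ℝ}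
    (hF : Continuous fun p : ℝ × ℝ × ℝ => F p.1 p.2.1 p.2.2)
    (hF' : Continuous fun p : ℝ × ℝ × ℝ => F' p.1 p.2.1 p.2.2)
    (h : ∀ t x y, HasDerivAt (fun s => F s x y) (F' t x y) t) (t : ℝ) :
    HasDerivAt (fun s => rectIntegral R L (F s)) (rectIntegral R L (F' t)) t := by
  have cont : ∀ {G : ℝ → ℝ → ℝ → ℝ}, (Continuous fun p : ℝ × ℝ × ℝ => G p.1 p.2.1 p.2.2) →
      Continuous fun p : ℝ × ℝ => ∫ y in (0:ℝ)..L, G p.1 p.2 y := fun {G} hG =>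
    intervalIntegral.continuous_parametric_intervalIntegral_of_continuous'
      (f := fun (p : ℝ × ℝ) y => G p.1 p.2 y)
      (show Continuous fun q : (ℝ × ℝ) × ℝ => G q.1.1 q.1.2 q.2 from
        hG.comp (g := fun p : ℝ × ℝ × ℝ => G p.1 p.2.1 p.2.2)
          (f := fun q : (ℝ × ℝ) × ℝ => (q.1.1, q.1.2, q.2)) (by fun_prop)) 0 L
  refine hasDerivAt_intervalIntegral_of_continuous (-R) R
    (F := fun s x => ∫ y in (0:ℝ)..L, F s x y) (F' := fun s x => ∫ y in (0:ℝ)..L, F' s x y)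
    (cont hF) (cont hF') (fun s x => ?_) t
  exact hasDerivAt_intervalIntegral_of_continuous 0 L (F := fun s y => F s x y)
    (F' := fun s y => F' s x y)
    (hF.comp (g := fun p : ℝ × ℝ × ℝ => F p.1 p.2.1 p.2.2)
      (f := fun q : ℝ × ℝ => (q.1, x, q.2)) (by fun_prop))
    (hF'.comp (g := fun p : ℝ × ℝ × ℝ => F' p.1 p.2.1 p.2.2)
      (f := fun q : ℝ × ℝ => (q.1, x, q.2)) (by fun_prop)) (fun s y => h s x y) s

theorem sq_le_mul_integral_deriv_sq {f f' : ℝ → ℝ} {L : ℝ} (hf' : Continuous f')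
    (h : ∀ y, HasDerivAt f (f' y) y) (h0 : f 0 = 0) {y : ℝ} (hy : y ∈ Icc 0 L) :
    f y ^ 2 ≤ L * ∫ s in (0:ℝ)..L, f' s ^ 2 := by
  have hmono : ∫ s in (0:ℝ)..y, f' s ^ 2 ≤ ∫ s in (0:ℝ)..L, f' s ^ 2 :=
    intervalIntegral.integral_mono_interval le_rfl hy.1 hy.2
      (Filter.Eventually.of_forall fun s => sq_nonneg _)
      ((show Continuous fun s => f' s ^ 2 by fun_prop).intervalIntegrable _ _)
  have h0' : 0 ≤ ∫ s in (0:ℝ)..y, f' s ^ 2 :=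
    intervalIntegral.integral_nonneg hy.1 fun s _ => sq_nonneg _
  have hftc : ∫ s in (0:ℝ)..y, f' s = f y := by
    rw [intervalIntegral.integral_eq_sub_of_hasDerivAt (fun s _ => h s)
      (hf'.intervalIntegrable _ _), h0, sub_zero]
  have hcs : f y ^ 2 ≤ y * ∫ s in (0:ℝ)..y, f' s ^ 2 := by
    rcases hy.1.eq_or_lt with rfl | hpos
    · simp [h0]
    have hsq : 0 ≤ ∫ s in (0:ℝ)..y, (y * f' s - f y) ^ 2 :=
      intervalIntegral.integral_nonneg hy.1 fun s _ => sq_nonneg _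
    have hexp : ∫ s in (0:ℝ)..y, (y * f' s - f y) ^ 2
        = y * (y * (∫ s in (0:ℝ)..y, f' s ^ 2) - f y ^ 2) := by
      have : ∀ s, (y * f' s - f y) ^ 2 = y ^ 2 * f' s ^ 2 + (-(2 * y * f y) * f' s + f y ^ 2) :=
        fun s => by ring
      simp only [this]
      rw [intervalIntegral.integral_add, intervalIntegral.integral_add,
        intervalIntegral.integral_const_mul, intervalIntegral.integral_const_mul, hftc,
        intervalIntegral.integral_const]
      · simp only [smul_eq_mul]; ring
      all_goals exact Continuous.intervalIntegrable (by fun_prop) _ _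
    rw [hexp] at hsq
    nlinarith [nonneg_of_mul_nonneg_right hsq hpos]
  calc f y ^ 2 ≤ y * ∫ s in (0:ℝ)..y, f' s ^ 2 := hcs
    _ ≤ L * ∫ s in (0:ℝ)..L, f' s ^ 2 := mul_le_mul hy.2 hmono h0' (hy.1.trans hy.2)

theorem hasDerivAt_exp_mul (c x : ℝ) :
    HasDerivAt (fun s => Real.exp (c * s)) (c * Real.exp (c * x)) x := by
  simpa [mul_comm] using ((hasDerivAt_id x).const_mul c).exp

theorem rectIntegral_energy_le {R L α b M : ℝ} (hR : 0 ≤ R) (hL : 0 ≤ L)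
    {v vt vx vxx vxxx vy vyy vxy vxyy a₁ a₁x a₂ a₂y a₀ : ℝ → ℝ → ℝ}
    (cv : Continuous fun p : ℝ × ℝ => v p.1 p.2)
    (cvt : Continuous fun p : ℝ × ℝ => vt p.1 p.2)
    (cvx : Continuous fun p : ℝ × ℝ => vx p.1 p.2)
    (cvxx : Continuous fun p : ℝ × ℝ => vxx p.1 p.2)
    (cvxxx : Continuous fun p : ℝ × ℝ => vxxx p.1 p.2)
    (cvy : Continuous fun p : ℝ × ℝ => vy p.1 p.2)
    (cvyy : Continuous fun p : ℝ × ℝ => vyy p.1 p.2)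
    (cvxy : Continuous fun p : ℝ × ℝ => vxy p.1 p.2)
    (cvxyy : Continuous fun p : ℝ × ℝ => vxyy p.1 p.2)
    (ca₁ : Continuous fun p : ℝ × ℝ => a₁ p.1 p.2)
    (ca₁x : Continuous fun p : ℝ × ℝ => a₁x p.1 p.2)
    (ca₂ : Continuous fun p : ℝ × ℝ => a₂ p.1 p.2)
    (ca₂y : Continuous fun p : ℝ × ℝ => a₂y p.1 p.2)
    (dv : ∀ x y, HasDerivAt (fun s => v s y) (vx x y) x)
    (dvx : ∀ x y, HasDerivAt (fun s => vx s y) (vxx x y) x)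
    (dvxx : ∀ x y, HasDerivAt (fun s => vxx s y) (vxxx x y) x)
    (dv' : ∀ x y, HasDerivAt (fun s => v x s) (vy x y) y)
    (dvy : ∀ x y, HasDerivAt (fun s => vy s y) (vxy x y) x)
    (dvy' : ∀ x y, HasDerivAt (fun s => vy x s) (vyy x y) y)
    (dvxy' : ∀ x y, HasDerivAt (fun s => vxy x s) (vxyy x y) y)
    (da₁ : ∀ x y, HasDerivAt (fun s => a₁ s y) (a₁x x y) x)
    (da₂ : ∀ x y, HasDerivAt (fun s => a₂ x s) (a₂y x y) y)
    (ha₁M : ∀ x y, a₁ x y ≤ M) (ha₁ : ∀ x y, 0 ≤ a₁ x y) (ha₂ : ∀ x y, 0 ≤ a₂ x y)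
    (ha₀ : ∀ x y, 0 ≤ a₀ x y)
    (hpde : ∀ x, ∀ y ∈ Icc 0 L, vt x y + b * vx x y + vxxx x y + vxyy x y + v x y * vx x y
      - (a₁x x y * vx x y + a₁ x y * vxx x y) - (a₂y x y * vy x y + a₂ x y * vyy x y)
      + a₀ x y * v x y = 0)
    (hvl : ∀ y, v (-R) y = 0) (hvr : ∀ y, v R y = 0)
    (hvxl : ∀ y, vx (-R) y = 0) (hvxr : ∀ y, vx R y = 0)
    (hvyl : ∀ y, vy (-R) y = 0) (hvyr : ∀ y, vy R y = 0)
    (hv0 : ∀ x, v x 0 = 0) (hvL : ∀ x, v x L = 0) :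
    rectIntegral R L (fun x y => Real.exp (2 * α * x) * (2 * v x y * vt x y)) ≤
      2 * α * (-3 * rectIntegral R L (fun x y => Real.exp (2 * α * x) * vx x y ^ 2)
        - rectIntegral R L (fun x y => Real.exp (2 * α * x) * vy x y ^ 2)
        + (b + 4 * α ^ 2 + α * M)
          * rectIntegral R L (fun x y => Real.exp (2 * α * x) * v x y ^ 2)
        + 2 / 3 * rectIntegral R L (fun x y => Real.exp (2 * α * x) * v x y ^ 3)) := by
  set P' : ℝ → ℝ → ℝ := fun x y => 2 * α * Real.exp (2 * α * x) *
      (b * v x y ^ 2 + 2 * v x y * vxx x y - vx x y ^ 2 - 4 * α * (v x y * vx x y)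
        + 4 * α ^ 2 * v x y ^ 2 - vy x y ^ 2 + 2 / 3 * v x y ^ 3
        - 2 * v x y * (a₁ x y * vx x y))
    + Real.exp (2 * α * x) *
      (b * (2 * v x y * vx x y) + 2 * (vx x y * vxx x y + v x y * vxxx x y)
        - 2 * vx x y * vxx x y - 4 * α * (vx x y * vx x y + v x y * vxx x y)
        + 4 * α ^ 2 * (2 * v x y * vx x y) - 2 * vy x y * vxy x y
        + 2 / 3 * (3 * v x y ^ 2 * vx x y)
        - 2 * (vx x y * (a₁ x y * vx x y)
          + v x y * (a₁x x y * vx x y + a₁ x y * vxx x y))) with hP'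
  set Q' : ℝ → ℝ → ℝ := fun x y => Real.exp (2 * α * x) *
      (2 * (vy x y * vxy x y + v x y * vxyy x y)
        - 2 * (vy x y * (a₂ x y * vy x y)
          + v x y * (a₂y x y * vy x y + a₂ x y * vyy x y))) with hQ'
  have cP' : Continuous fun p : ℝ × ℝ => P' p.1 p.2 := by simp only [hP']; fun_prop
  have cQ' : Continuous fun p : ℝ × ℝ => Q' p.1 p.2 := by simp only [hQ']; fun_prop
  have hP0 : rectIntegral R L P' = 0 := by
    refine rectIntegral_deriv_fst_eq_zero (G := fun x y => Real.exp (2 * α * x) *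
      (b * v x y ^ 2 + 2 * v x y * vxx x y - vx x y ^ 2 - 4 * α * (v x y * vx x y)
        + 4 * α ^ 2 * v x y ^ 2 - vy x y ^ 2 + 2 / 3 * v x y ^ 3
        - 2 * v x y * (a₁ x y * vx x y))) (by fun_prop) cP' (fun x y => ?_) ?_ ?_
    · have hv := dv x y
      have hvx := dvx x y
      have h := (hasDerivAt_exp_mul (2 * α) x).fun_mul
        ((((((((hv.fun_pow 2).const_mul b).fun_add ((hv.const_mul 2).fun_mul (dvxx x y))).fun_sub
          (hvx.fun_pow 2)).fun_sub ((hv.fun_mul hvx).const_mul (4 * α))).fun_add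
          ((hv.fun_pow 2).const_mul (4 * α ^ 2))).fun_sub ((dvy x y).fun_pow 2)).fun_add
          ((hv.fun_pow 3).const_mul (2 / 3)) |>.fun_sub
          ((hv.const_mul 2).fun_mul ((da₁ x y).fun_mul hvx)))
      refine h.congr_deriv ?_
      simp only [hP']
      push_cast
      ring
    · intro y; simp [hvl, hvxl, hvyl]
    · intro y; simp [hvr, hvxr, hvyr]
  have hQ0 : rectIntegral R L Q' = 0 := by
    refine rectIntegral_deriv_snd_eq_zero (G := fun x y => Real.exp (2 * α * x) *
      (2 * (v x y * vxy x y) - 2 * (v x y * (a₂ x y * vy x y)))) cQ' (fun x y => ?_) ?_ ?_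
    · have hv := dv' x y
      have h := (((hv.fun_mul (dvxy' x y)).const_mul 2).fun_sub
        ((hv.fun_mul ((da₂ x y).fun_mul (dvy' x y))).const_mul 2)).const_mul
          (Real.exp (2 * α * x))
      exact h
    · intro x; simp [hv0]
    · intro x; simp [hvL]
  have hpt : ∀ x, ∀ y ∈ Icc 0 L,
      (Real.exp (2 * α * x) * (2 * v x y * vt x y) + P' x y) + Q' x y ≤
      (2 * α * -3) * (Real.exp (2 * α * x) * vx x y ^ 2)
        + ((2 * α * -1) * (Real.exp (2 * α * x) * vy x y ^ 2)
        + ((2 * α * (b + 4 * α ^ 2 + α * M)) * (Real.exp (2 * α * x) * v x y ^ 2)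
        + (2 * α * (2 / 3)) * (Real.exp (2 * α * x) * v x y ^ 3))) := by
    intro x y hy
    have hvt := hpde x y hy
    have hw := (Real.exp_pos (2 * α * x)).le
    simp only [hP', hQ']
    generalize Real.exp (2 * α * x) = w at hw ⊢
    have h₁ : 0 ≤ w * (a₁ x y * (vx x y + α * v x y) ^ 2) :=
      mul_nonneg hw (mul_nonneg (ha₁ x y) (sq_nonneg _))
    have h₂ : 0 ≤ w * (a₂ x y * vy x y ^ 2) := mul_nonneg hw (mul_nonneg (ha₂ x y) (sq_nonneg _))
    have h₃ : 0 ≤ w * (a₀ x y * v x y ^ 2) := mul_nonneg hw (mul_nonneg (ha₀ x y) (sq_nonneg _))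
    have h₄ : 0 ≤ w * (α ^ 2 * ((M - a₁ x y) * v x y ^ 2)) :=
      mul_nonneg hw (mul_nonneg (sq_nonneg _)
        (mul_nonneg (sub_nonneg.2 (ha₁M x y)) (sq_nonneg _)))
    linear_combination 2 * h₁ + 2 * h₂ + 2 * h₃ + 2 * h₄ + 2 * w * v x y * hvt
  have hint := rectIntegral_mono hR hL (by fun_prop) (by fun_prop) hpt
  rw [rectIntegral_add (by fun_prop) cQ', rectIntegral_add (by fun_prop) cP', hP0, hQ0,
    rectIntegral_add (by fun_prop) (by fun_prop), rectIntegral_add (by fun_prop) (by fun_prop),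
    rectIntegral_add (by fun_prop) (by fun_prop)] at hint
  simp only [rectIntegral_const_mul] at hint
  linarith

theorem integral_sq_le_sq_mul_integral_deriv_sq {f f' : ℝ → ℝ} {L : ℝ} (hL : 0 ≤ L)
    (hf' : Continuous f') (h : ∀ y, HasDerivAt f (f' y) y) (h0 : f 0 = 0) :
    ∫ s in (0:ℝ)..L, f s ^ 2 ≤ L ^ 2 * ∫ s in (0:ℝ)..L, f' s ^ 2 := by
  have cf : Continuous f := continuous_iff_continuousAt.2 fun y => (h y).continuousAt
  calc ∫ s in (0:ℝ)..L, f s ^ 2 ≤ ∫ _ in (0:ℝ)..L, L * ∫ s in (0:ℝ)..L, f' s ^ 2 :=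
        intervalIntegral.integral_mono_on hL ((cf.pow 2).intervalIntegrable _ _)
          intervalIntegrable_const fun y hy => sq_le_mul_integral_deriv_sq hf' h h0 hy
    _ = L ^ 2 * ∫ s in (0:ℝ)..L, f' s ^ 2 := by
        rw [intervalIntegral.integral_const, smul_eq_mul]; ring

theorem integral_cube_le {f f' : ℝ → ℝ} {L ε : ℝ} (hL : 0 ≤ L) (hε : 0 < ε)
    (hf' : Continuous f') (h : ∀ y, HasDerivAt f (f' y) y) (h0 : f 0 = 0) :
    ∫ s in (0:ℝ)..L, f s ^ 3 ≤ ε / 2 * (L * ∫ s in (0:ℝ)..L, f' s ^ 2)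
      + 1 / (2 * ε) * (∫ s in (0:ℝ)..L, f s ^ 2) ^ 2 := by
  have cf : Continuous f := continuous_iff_continuousAt.2 fun y => (h y).continuousAt
  set A := L * ∫ s in (0:ℝ)..L, f' s ^ 2
  set q := ∫ s in (0:ℝ)..L, f s ^ 2
  have hA : 0 ≤ A := mul_nonneg hL (intervalIntegral.integral_nonneg hL fun s _ => sq_nonneg _)
  have h₁ : ∫ s in (0:ℝ)..L, f s ^ 3 ≤ √A * q := by
    rw [← intervalIntegral.integral_const_mul]
    refine intervalIntegral.integral_mono_on hL ((cf.pow 3).intervalIntegrable _ _)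
      (((cf.pow 2).const_mul _).intervalIntegrable _ _) fun y hy => ?_
    have : f y ≤ √A := Real.le_sqrt_of_sq_le (sq_le_mul_integral_deriv_sq hf' h h0 hy)
    nlinarith [sq_nonneg (f y)]
  have h₂ : √A * q ≤ ε / 2 * A + 1 / (2 * ε) * q ^ 2 := by
    have hs : √A ^ 2 = A := Real.sq_sqrt hA
    have : ε / 2 * A + 1 / (2 * ε) * q ^ 2 - √A * q = 1 / (2 * ε) * (ε * √A - q) ^ 2 := by
      rw [← hs, Real.sqrt_sq (Real.sqrt_nonneg A)]
      field_simp
      ring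
    have : 0 ≤ 1 / (2 * ε) * (ε * √A - q) ^ 2 := by positivity
    linarith
  exact h₁.trans h₂

section Weighted

variable {R L α : ℝ} {v vx vy : ℝ → ℝ → ℝ}

theorem rectIntegral_sq_le (hR : 0 ≤ R) (hL : 0 ≤ L)
    (cv : Continuous fun p : ℝ × ℝ => v p.1 p.2)
    (cvy : Continuous fun p : ℝ × ℝ => vy p.1 p.2)
    (dv' : ∀ x y, HasDerivAt (fun s => v x s) (vy x y) y) (hv0 : ∀ x, v x 0 = 0) :
    rectIntegral R L (fun x y => Real.exp (2 * α * x) * v x y ^ 2) ≤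
      L ^ 2 * rectIntegral R L (fun x y => Real.exp (2 * α * x) * vy x y ^ 2) := by
  unfold rectIntegral
  rw [← intervalIntegral.integral_const_mul]
  refine intervalIntegral.integral_mono_on (by linarith)
    ((continuous_integral_right 0 L (by fun_prop)).intervalIntegrable _ _)
    (((continuous_integral_right 0 L (by fun_prop)).const_mul _).intervalIntegrable _ _)
    fun x _ => ?_
  have h := integral_sq_le_sq_mul_integral_deriv_sq hL (show Continuous (vy x) by fun_prop)
    (dv' x) (hv0 x)
  simp only [intervalIntegral.integral_const_mul]
  calc _ ≤ Real.exp (2 * α * x) * (L ^ 2 * ∫ s in (0:ℝ)..L, vy x s ^ 2) := by gcongr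
    _ = _ := by ring

theorem exp_mul_integral_sq_le (hL : 0 ≤ L) (hα : 0 ≤ α)
    (cv : Continuous fun p : ℝ × ℝ => v p.1 p.2)
    (cvx : Continuous fun p : ℝ × ℝ => vx p.1 p.2)
    (dv : ∀ x y, HasDerivAt (fun s => v s y) (vx x y) x)
    (hvl : ∀ y, v (-R) y = 0) {x : ℝ} (hx : x ∈ Icc (-R) R) :
    Real.exp (2 * α * x) * ∫ y in (0:ℝ)..L, v x y ^ 2 ≤
      rectIntegral R L (fun x y => Real.exp (2 * α * x) * vx x y ^ 2)
        + (2 * α + 1) * rectIntegral R L (fun x y => Real.exp (2 * α * x) * v x y ^ 2) := by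
  set G' : ℝ → ℝ → ℝ := fun x y => 2 * α * Real.exp (2 * α * x) * v x y ^ 2
    + Real.exp (2 * α * x) * (2 * v x y * vx x y) with hG'
  set K : ℝ → ℝ → ℝ := fun x y => Real.exp (2 * α * x) * vx x y ^ 2
    + (2 * α + 1) * (Real.exp (2 * α * x) * v x y ^ 2) with hK
  have cG' : Continuous fun p : ℝ × ℝ => G' p.1 p.2 := by simp only [hG']; fun_prop
  have cK : Continuous fun p : ℝ × ℝ => K p.1 p.2 := by simp only [hK]; fun_prop
  have cG'i := continuous_integral_right 0 L cG'
  have cKi := continuous_integral_right 0 L cK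
  have hd : ∀ s, HasDerivAt (fun x => ∫ y in (0:ℝ)..L, Real.exp (2 * α * x) * v x y ^ 2)
      (∫ y in (0:ℝ)..L, G' s y) s := fun s => by
    refine hasDerivAt_intervalIntegral_of_continuous 0 L
      (F := fun x y => Real.exp (2 * α * x) * v x y ^ 2) (by fun_prop) cG' (fun x y => ?_) s
    refine ((hasDerivAt_exp_mul (2 * α) x).fun_mul ((dv x y).fun_pow 2)).congr_deriv ?_
    simp [hG']
  have hGK : ∀ x y, G' x y ≤ K x y := fun x y => by
    have : 0 ≤ Real.exp (2 * α * x) * (v x y - vx x y) ^ 2 := by positivity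
    simp only [hG', hK]
    linarith
  have hK0 : ∀ x y, 0 ≤ K x y := fun x y => by simp only [hK]; positivity
  have hftc := intervalIntegral.integral_eq_sub_of_hasDerivAt (a := -R) (b := x)
    (fun s _ => hd s) (cG'i.intervalIntegrable _ _)
  simp only [hvl, intervalIntegral.integral_const_mul] at hftc
  simp only [ne_eq, OfNat.ofNat_ne_zero, not_false_eq_true, zero_pow,
    intervalIntegral.integral_zero, mul_zero, sub_zero] at hftc
  rw [← hftc]
  calc ∫ s in (-R)..x, ∫ y in (0:ℝ)..L, G' s y ≤ ∫ s in (-R)..x, ∫ y in (0:ℝ)..L, K s y :=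
        intervalIntegral.integral_mono_on hx.1 (cG'i.intervalIntegrable _ _)
          (cKi.intervalIntegrable _ _) fun s _ =>
          intervalIntegral.integral_mono_on hL
            ((show Continuous (G' s) by fun_prop).intervalIntegrable _ _)
            ((show Continuous (K s) by fun_prop).intervalIntegrable _ _) fun y _ => hGK s y
    _ ≤ rectIntegral R L K :=
        intervalIntegral.integral_mono_interval le_rfl hx.1 hx.2
          (Filter.Eventually.of_forall fun s =>
            intervalIntegral.integral_nonneg hL fun y _ => hK0 s y)
          (cKi.intervalIntegrable _ _)
    _ = _ := by
        rw [hK, rectIntegral_add (by fun_prop) (by fun_prop), rectIntegral_const_mul]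

theorem rectIntegral_cube_le {ε : ℝ} (hR : 0 ≤ R) (hL : 0 ≤ L) (hα : 0 ≤ α) (hε : 0 < ε)
    (cv : Continuous fun p : ℝ × ℝ => v p.1 p.2)
    (cvx : Continuous fun p : ℝ × ℝ => vx p.1 p.2)
    (cvy : Continuous fun p : ℝ × ℝ => vy p.1 p.2)
    (dv : ∀ x y, HasDerivAt (fun s => v s y) (vx x y) x)
    (dv' : ∀ x y, HasDerivAt (fun s => v x s) (vy x y) y) (hv0 : ∀ x, v x 0 = 0)
    (hvl : ∀ y, v (-R) y = 0)
    (hsmall : rectIntegral R L (fun x y => v x y ^ 2) ≤ ε ^ 2) :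
    rectIntegral R L (fun x y => Real.exp (2 * α * x) * v x y ^ 3) ≤
      ε / 2 * (L * rectIntegral R L (fun x y => Real.exp (2 * α * x) * vy x y ^ 2)
        + rectIntegral R L (fun x y => Real.exp (2 * α * x) * vx x y ^ 2)
        + (2 * α + 1) * rectIntegral R L (fun x y => Real.exp (2 * α * x) * v x y ^ 2)) := by
  set S := rectIntegral R L (fun x y => Real.exp (2 * α * x) * vx x y ^ 2)
        + (2 * α + 1) * rectIntegral R L (fun x y => Real.exp (2 * α * x) * v x y ^ 2) with hS
  have hS0 : 0 ≤ S := by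
    have h₁ := rectIntegral_nonneg (F := fun x y => Real.exp (2 * α * x) * vx x y ^ 2) hR hL
      fun x y _ => by positivity
    have h₂ := rectIntegral_nonneg (F := fun x y => Real.exp (2 * α * x) * v x y ^ 2) hR hL
      fun x y _ => by positivity
    positivity
  have hbound : rectIntegral R L (fun x y => Real.exp (2 * α * x) * v x y ^ 3) ≤
      rectIntegral R L (fun x y => ε / 2 * L * (Real.exp (2 * α * x) * vy x y ^ 2)
        + S / (2 * ε) * v x y ^ 2) := by
    refine intervalIntegral.integral_mono_on (by linarith)
      ((continuous_integral_right 0 L (by fun_prop)).intervalIntegrable _ _)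
      ((continuous_integral_right 0 L (by fun_prop)).intervalIntegrable _ _) fun x hx => ?_
    rw [intervalIntegral.integral_add]
    · simp only [intervalIntegral.integral_const_mul]
      have h₁ := integral_cube_le hL hε (show Continuous (vy x) by fun_prop) (dv' x) (hv0 x)
      have h₂ := exp_mul_integral_sq_le hL hα cv cvx dv hvl hx
      rw [← hS] at h₂
      have hq : 0 ≤ ∫ y in (0:ℝ)..L, v x y ^ 2 :=
        intervalIntegral.integral_nonneg hL fun y _ => sq_nonneg _
      calc _ ≤ Real.exp (2 * α * x) * (ε / 2 * (L * ∫ s in (0:ℝ)..L, vy x s ^ 2)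
              + 1 / (2 * ε) * (∫ s in (0:ℝ)..L, v x s ^ 2) ^ 2) := by gcongr
        _ = ε / 2 * L * (Real.exp (2 * α * x) * ∫ s in (0:ℝ)..L, vy x s ^ 2)
            + 1 / (2 * ε) * ((Real.exp (2 * α * x) * ∫ s in (0:ℝ)..L, v x s ^ 2)
              * ∫ s in (0:ℝ)..L, v x s ^ 2) := by ring
        _ ≤ ε / 2 * L * (Real.exp (2 * α * x) * ∫ s in (0:ℝ)..L, vy x s ^ 2)
            + 1 / (2 * ε) * (S * ∫ s in (0:ℝ)..L, v x s ^ 2) := by gcongr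
        _ = _ := by ring
    all_goals exact Continuous.intervalIntegrable (by fun_prop) _ _
  rw [rectIntegral_add (by fun_prop) (by fun_prop), rectIntegral_const_mul,
    rectIntegral_const_mul] at hbound
  have : S / (2 * ε) * rectIntegral R L (fun x y => v x y ^ 2) ≤ ε / 2 * S :=
    calc _ ≤ S / (2 * ε) * ε ^ 2 := by gcongr
      _ = _ := by field_simp
  linarith

end Weighted

theorem le_exp_neg_mul_of_hasDerivAt_le {f f' : ℝ → ℝ} {k T : ℝ}
    (h : ∀ t, HasDerivAt f (f' t) t) (hle : ∀ t ∈ Icc 0 T, f' t ≤ -k * f t) {t : ℝ}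
    (ht : t ∈ Icc 0 T) : f t ≤ Real.exp (-(k * t)) * f 0 := by
  have hd : ∀ s, HasDerivAt (fun s => Real.exp (k * s) * f s)
      (k * Real.exp (k * s) * f s + Real.exp (k * s) * f' s) s := fun s =>
    (hasDerivAt_exp_mul k s).fun_mul (h s)
  have hanti : AntitoneOn (fun s => Real.exp (k * s) * f s) (Icc 0 T) := by
    refine antitoneOn_of_deriv_nonpos (convex_Icc 0 T)
      (fun s _ => (hd s).continuousAt.continuousWithinAt)
      (fun s _ => (hd s).differentiableAt.differentiableWithinAt) fun s hs => ?_
    rw [(hd s).deriv]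
    have := mul_le_mul_of_nonneg_left (hle s (interior_subset hs)) (Real.exp_pos (k * s)).le
    linarith
  have key := hanti ⟨le_rfl, ht.1.trans ht.2⟩ ht ht.1
  simp only [mul_zero, Real.exp_zero, one_mul] at key
  calc f t = Real.exp (-(k * t)) * (Real.exp (k * t) * f t) := by
        rw [← mul_assoc, ← Real.exp_add, neg_add_cancel, Real.exp_zero, one_mul]
    _ ≤ _ := by gcongr

section Smooth

variable {u : ℝ → ℝ → ℝ → ℝ}

theorem hasDerivAt_fderiv_Dt {n : WithTop ℕ∞} (hn : n ≠ 0)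
    (hu : ContDiff ℝ n fun p : ℝ × ℝ × ℝ => u p.1 p.2.1 p.2.2)
    (t x y : ℝ) : HasDerivAt (fun s => u s x y)
      (fderiv ℝ (fun p : ℝ × ℝ × ℝ => u p.1 p.2.1 p.2.2) (t, x, y) (1, 0, 0)) t :=
  HasFDerivAt.comp_hasDerivAt (f := fun s : ℝ => (s, x, y)) t
    (hu.differentiable hn (t, x, y)).hasFDerivAt
    ((hasDerivAt_id t).prodMk ((hasDerivAt_const t x).prodMk (hasDerivAt_const t y)))

theorem hasDerivAt_fderiv_Dx {n : WithTop ℕ∞} (hn : n ≠ 0)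
    (hu : ContDiff ℝ n fun p : ℝ × ℝ × ℝ => u p.1 p.2.1 p.2.2)
    (t x y : ℝ) : HasDerivAt (fun s => u t s y)
      (fderiv ℝ (fun p : ℝ × ℝ × ℝ => u p.1 p.2.1 p.2.2) (t, x, y) (0, 1, 0)) x :=
  HasFDerivAt.comp_hasDerivAt (f := fun s : ℝ => (t, s, y)) x
    (hu.differentiable hn (t, x, y)).hasFDerivAt
    ((hasDerivAt_const x t).prodMk ((hasDerivAt_id x).prodMk (hasDerivAt_const x y)))

theorem hasDerivAt_fderiv_Dy {n : WithTop ℕ∞} (hn : n ≠ 0)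
    (hu : ContDiff ℝ n fun p : ℝ × ℝ × ℝ => u p.1 p.2.1 p.2.2)
    (t x y : ℝ) : HasDerivAt (fun s => u t x s)
      (fderiv ℝ (fun p : ℝ × ℝ × ℝ => u p.1 p.2.1 p.2.2) (t, x, y) (0, 0, 1)) y :=
  HasFDerivAt.comp_hasDerivAt (f := fun s : ℝ => (t, x, s)) y
    (hu.differentiable hn (t, x, y)).hasFDerivAt
    ((hasDerivAt_const y t).prodMk ((hasDerivAt_const y x).prodMk (hasDerivAt_id y)))

theorem Dx_eq_fderiv {n : WithTop ℕ∞} (hn : n ≠ 0)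
    (hu : ContDiff ℝ n fun p : ℝ × ℝ × ℝ => u p.1 p.2.1 p.2.2) (t x y : ℝ) :
    Dx u t x y = fderiv ℝ (fun p : ℝ × ℝ × ℝ => u p.1 p.2.1 p.2.2) (t, x, y) (0, 1, 0) :=
  (hasDerivAt_fderiv_Dx hn hu t x y).deriv

theorem Dy_eq_fderiv {n : WithTop ℕ∞} (hn : n ≠ 0)
    (hu : ContDiff ℝ n fun p : ℝ × ℝ × ℝ => u p.1 p.2.1 p.2.2) (t x y : ℝ) :
    Dy u t x y = fderiv ℝ (fun p : ℝ × ℝ × ℝ => u p.1 p.2.1 p.2.2) (t, x, y) (0, 0, 1) :=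
  (hasDerivAt_fderiv_Dy hn hu t x y).deriv

theorem hasDerivAt_Dt {n : WithTop ℕ∞} (hn : n ≠ 0)
    (hu : ContDiff ℝ n fun p : ℝ × ℝ × ℝ => u p.1 p.2.1 p.2.2) (t x y : ℝ) :
    HasDerivAt (fun s => u s x y) (Dt u t x y) t :=
  (hasDerivAt_fderiv_Dt hn hu t x y).differentiableAt.hasDerivAt

theorem hasDerivAt_Dx {n : WithTop ℕ∞} (hn : n ≠ 0)
    (hu : ContDiff ℝ n fun p : ℝ × ℝ × ℝ => u p.1 p.2.1 p.2.2) (t x y : ℝ) :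
    HasDerivAt (fun s => u t s y) (Dx u t x y) x :=
  (hasDerivAt_fderiv_Dx hn hu t x y).differentiableAt.hasDerivAt

theorem hasDerivAt_Dy {n : WithTop ℕ∞} (hn : n ≠ 0)
    (hu : ContDiff ℝ n fun p : ℝ × ℝ × ℝ => u p.1 p.2.1 p.2.2) (t x y : ℝ) :
    HasDerivAt (fun s => u t x s) (Dy u t x y) y :=
  (hasDerivAt_fderiv_Dy hn hu t x y).differentiableAt.hasDerivAt

theorem ContDiff.Dt {m n : WithTop ℕ∞} (hmn : m + 1 ≤ n)
    (hu : ContDiff ℝ n fun p : ℝ × ℝ × ℝ => u p.1 p.2.1 p.2.2) :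
    ContDiff ℝ m fun p : ℝ × ℝ × ℝ => Dt u p.1 p.2.1 p.2.2 := by
  have hn : n ≠ 0 := by rintro rfl; simp at hmn
  have : (fun p : ℝ × ℝ × ℝ => _root_.Dt u p.1 p.2.1 p.2.2) = fun p =>
      fderiv ℝ (fun p : ℝ × ℝ × ℝ => u p.1 p.2.1 p.2.2) p (1, 0, 0) :=
    funext fun p => (hasDerivAt_fderiv_Dt hn hu p.1 p.2.1 p.2.2).deriv
  rw [this]
  exact (hu.fderiv_right hmn).clm_apply contDiff_const

theorem ContDiff.Dx {m n : WithTop ℕ∞} (hmn : m + 1 ≤ n)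
    (hu : ContDiff ℝ n fun p : ℝ × ℝ × ℝ => u p.1 p.2.1 p.2.2) :
    ContDiff ℝ m fun p : ℝ × ℝ × ℝ => Dx u p.1 p.2.1 p.2.2 := by
  have hn : n ≠ 0 := by rintro rfl; simp at hmn
  have : (fun p : ℝ × ℝ × ℝ => _root_.Dx u p.1 p.2.1 p.2.2) = fun p =>
      fderiv ℝ (fun p : ℝ × ℝ × ℝ => u p.1 p.2.1 p.2.2) p (0, 1, 0) :=
    funext fun p => Dx_eq_fderiv hn hu p.1 p.2.1 p.2.2
  rw [this]
  exact (hu.fderiv_right hmn).clm_apply contDiff_const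

theorem ContDiff.Dy {m n : WithTop ℕ∞} (hmn : m + 1 ≤ n)
    (hu : ContDiff ℝ n fun p : ℝ × ℝ × ℝ => u p.1 p.2.1 p.2.2) :
    ContDiff ℝ m fun p : ℝ × ℝ × ℝ => Dy u p.1 p.2.1 p.2.2 := by
  have hn : n ≠ 0 := by rintro rfl; simp at hmn
  have : (fun p : ℝ × ℝ × ℝ => _root_.Dy u p.1 p.2.1 p.2.2) = fun p =>
      fderiv ℝ (fun p : ℝ × ℝ × ℝ => u p.1 p.2.1 p.2.2) p (0, 0, 1) :=
    funext fun p => Dy_eq_fderiv hn hu p.1 p.2.1 p.2.2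
  rw [this]
  exact (hu.fderiv_right hmn).clm_apply contDiff_const

theorem Dx_Dy_comm (hu : ContDiff ℝ 2 fun p : ℝ × ℝ × ℝ => u p.1 p.2.1 p.2.2) :
    Dx (Dy u) = Dy (Dx u) := by
  have h1 : (1 : WithTop ℕ∞) + 1 ≤ 2 := by norm_num
  have hf : Differentiable ℝ (fderiv ℝ fun p : ℝ × ℝ × ℝ => u p.1 p.2.1 p.2.2) :=
    (hu.fderiv_right h1).differentiable one_ne_zero
  have key : ∀ p v w : ℝ × ℝ × ℝ,
      fderiv ℝ (fun q => fderiv ℝ (fun p : ℝ × ℝ × ℝ => u p.1 p.2.1 p.2.2) q v) p w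
        = fderiv ℝ (fderiv ℝ fun p : ℝ × ℝ × ℝ => u p.1 p.2.1 p.2.2) p w v := fun p v w => by
    rw [fderiv_clm_apply (hf p) (differentiableAt_const v)]
    simp
  have hx : (fun p : ℝ × ℝ × ℝ => Dx u p.1 p.2.1 p.2.2) = fun p =>
      fderiv ℝ (fun p : ℝ × ℝ × ℝ => u p.1 p.2.1 p.2.2) p (0, 1, 0) :=
    funext fun p => Dx_eq_fderiv two_ne_zero hu p.1 p.2.1 p.2.2
  have hy : (fun p : ℝ × ℝ × ℝ => Dy u p.1 p.2.1 p.2.2) = fun p =>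
      fderiv ℝ (fun p : ℝ × ℝ × ℝ => u p.1 p.2.1 p.2.2) p (0, 0, 1) :=
    funext fun p => Dy_eq_fderiv two_ne_zero hu p.1 p.2.1 p.2.2
  funext t x y
  rw [Dx_eq_fderiv one_ne_zero (hu.Dy h1), Dy_eq_fderiv one_ne_zero (hu.Dx h1), hx, hy, key, key]
  exact (hu.contDiffAt.isSymmSndFDerivAt (by simp)) _ _

end Smooth

theorem weighted_dissipation_le {b L M α ε X Y E C : ℝ} (hL : 0 < L) (hb : b * L ^ 2 ≤ 1 / 2)
    (hM : 0 ≤ M) (hα : 0 < α) (hα₀ : α ≤ 1 / (8 * (4 + M) * (1 + L) ^ 2))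
    (hε : ε = 1 / (8 * (1 + L) ^ 2)) (hX : 0 ≤ X) (hY : 0 ≤ Y) (hE : 0 ≤ E)
    (hEY : E ≤ L ^ 2 * Y) (hC : C ≤ ε / 2 * (L * Y + X + (2 * α + 1) * E)) :
    2 * α * (-3 * X - Y + (b + 4 * α ^ 2 + α * M) * E + 2 / 3 * C)
      ≤ -(2 * α * (1 / (8 * L ^ 2))) * E := by
  have hε0 : 0 < ε := by rw [hε]; positivity
  have hεL : ε * (1 + L) ^ 2 = 1 / 8 := by rw [hε]; field_simp
  have hαM : α * (4 + M) * (1 + L) ^ 2 ≤ 1 / 8 := by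
    rw [le_div_iff₀ (by positivity)] at hα₀
    linarith
  have hL1 : 1 ≤ (1 + L) ^ 2 := by nlinarith
  have hL2 : L ^ 2 ≤ (1 + L) ^ 2 := by nlinarith
  have hL3 : L ≤ (1 + L) ^ 2 := by nlinarith
  have hα1 : α ≤ 1 := by nlinarith [mul_nonneg hα.le hM]
  have hε1 : ε ≤ 1 / 8 := by nlinarith
  have hbE : b * E ≤ 1 / 2 * Y := by
    rcases le_total b 0 with hb0 | hb0
    · nlinarith
    · calc b * E ≤ b * (L ^ 2 * Y) := by gcongr
        _ = (b * L ^ 2) * Y := by ring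
        _ ≤ _ := by gcongr
  have hαE : (4 * α ^ 2 + α * M) * E ≤ 1 / 8 * Y :=
    calc (4 * α ^ 2 + α * M) * E ≤ (α * (4 + M)) * (L ^ 2 * Y) := by
          gcongr
          nlinarith
      _ ≤ (α * (4 + M)) * ((1 + L) ^ 2 * Y) := by gcongr
      _ = (α * (4 + M) * (1 + L) ^ 2) * Y := by ring
      _ ≤ _ := by gcongr
  have hεY : ε * (L * Y) ≤ 1 / 8 * Y :=
    calc ε * (L * Y) ≤ ε * ((1 + L) ^ 2 * Y) := by gcongr
      _ = (ε * (1 + L) ^ 2) * Y := by ring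
      _ = _ := by rw [hεL]
  have hεE : ε * E ≤ 1 / 8 * Y :=
    calc ε * E ≤ ε * ((1 + L) ^ 2 * Y) := by gcongr; exact hEY.trans (by gcongr)
      _ = (ε * (1 + L) ^ 2) * Y := by ring
      _ = _ := by rw [hεL]
  have hεX : ε * X ≤ 1 / 8 * X := by gcongr
  have hαεE : α * (ε * E) ≤ 1 / 8 * Y :=
    (mul_le_of_le_one_left (by positivity) hα1).trans hεE
  have hfin : 1 / (8 * L ^ 2) * E ≤ 1 / 8 * Y :=
    calc 1 / (8 * L ^ 2) * E ≤ 1 / (8 * L ^ 2) * (L ^ 2 * Y) := by gcongr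
      _ = _ := by field_simp
  have hsum : -3 * X - Y + (b + 4 * α ^ 2 + α * M) * E + 2 / 3 * C ≤ -(1 / (8 * L ^ 2) * E) := by
    linarith
  calc _ ≤ 2 * α * -(1 / (8 * L ^ 2) * E) := by gcongr
    _ = _ := by ring

theorem integral_integral_Ioo_eq_rectIntegral {R L : ℝ} (hL : 0 ≤ L) {F : ℝ → ℝ → ℝ}
    (hF : ∀ x y, R ≤ |x| → F x y = 0) :
    ∫ x, ∫ y in Ioo 0 L, F x y = rectIntegral R L F := by
  unfold rectIntegral
  rw [intervalIntegral.integral_eq_integral_of_support_subset]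
  · simp only [intervalIntegral.integral_of_le hL, integral_Ioc_eq_integral_Ioo]
  · intro x hx
    have : |x| < R := by
      by_contra! h
      exact hx (by simp [hF x _ h])
    rw [abs_lt] at this
    exact ⟨this.1, this.2.le⟩

/-- Exponential decay of small solutions of the generalized Zakharov–Kuznetsov
equation in `L²` with exponential weight `e^{2αx}`: for `b ≤ 0` no restriction on
the width `L` of the strip is needed, while for `b > 0` there is a critical width
`L₀`. -/
theorem exponential_weighted_decay (b : ℝ) :
    ∃ L₀ : ℝ, 0 < L₀ ∧
      ∀ L : ℝ, 0 < L → (b ≤ 0 ∨ L < L₀) →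
        ∀ a₁ a₂ a₀ : ℝ → ℝ → ℝ,
          ContDiff ℝ 1 (fun p : ℝ × ℝ => a₁ p.1 p.2) →
          ContDiff ℝ 1 (fun p : ℝ × ℝ => a₂ p.1 p.2) →
          Continuous (fun p : ℝ × ℝ => a₀ p.1 p.2) →
          (∃ M : ℝ, ∀ x y : ℝ, |a₁ x y| ≤ M) →
          (∃ M : ℝ, ∀ x y : ℝ, |a₂ x y| ≤ M) →
          (∃ M : ℝ, ∀ x y : ℝ, |a₀ x y| ≤ M) →
          (∀ x y : ℝ, 0 ≤ a₁ x y) → (∀ x y : ℝ, 0 ≤ a₂ x y) →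
          (∀ x y : ℝ, 0 ≤ a₀ x y) →
          ∃ α₀ > 0, ∃ ε₀ > 0, ∃ β > 0,
            ∀ α : ℝ, 0 < α → α ≤ α₀ →
              ∀ T : ℝ, 0 < T →
                ∀ u : ℝ → ℝ → ℝ → ℝ,
                  ContDiff ℝ (⊤ : ℕ∞) (fun p : ℝ × ℝ × ℝ => u p.1 p.2.1 p.2.2) →
                  (∃ R > 0, ∀ t x y : ℝ, R ≤ |x| → u t x y = 0) →
                  (∀ t x : ℝ, u t x 0 = 0) → (∀ t x : ℝ, u t x L = 0) →
                  (∀ t ∈ Icc (0:ℝ) T, ∀ x : ℝ, ∀ y ∈ Icc (0:ℝ) L,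
                    Dt u t x y + b * Dx u t x y + Dx (Dx (Dx u)) t x y
                        + Dx (Dy (Dy u)) t x y + u t x y * Dx u t x y
                        - Dx (fun t x y => a₁ x y * Dx u t x y) t x y
                        - Dy (fun t x y => a₂ x y * Dy u t x y) t x y
                        + a₀ x y * u t x y
                      = 0) →
                  (∫ x : ℝ, ∫ y in Ioo (0:ℝ) L, (u 0 x y) ^ 2) ^ ((1:ℝ) / 2) ≤ ε₀ →
                  ∀ t ∈ Icc (0:ℝ) T,
                    (∫ x : ℝ, ∫ y in Ioo (0:ℝ) L,
                        Real.exp (2 * α * x) * (u t x y) ^ 2)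
                      ≤ Real.exp (-(2 * α * β * t))
                          * ∫ x : ℝ, ∫ y in Ioo (0:ℝ) L,
                              Real.exp (2 * α * x) * (u 0 x y) ^ 2 := by
  refine ⟨1 / (2 * (1 + |b|)), by positivity, ?_⟩
  rintro L hL hbL a₁ a₂ a₀ ha₁ ha₂ - ⟨M, hM⟩ - - ha₁0 ha₂0 ha₀0
  have hM0 : 0 ≤ M := (abs_nonneg _).trans (hM 0 0)
  have hb : b * L ^ 2 ≤ 1 / 2 := by
    rcases le_or_gt b 0 with hb | hb
    · nlinarith [sq_nonneg L]
    · have h := hbL.resolve_left hb.not_ge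
      rw [abs_of_pos hb, lt_div_iff₀ (by positivity)] at h
      have hL1 : L ≤ 1 := by nlinarith [mul_pos hL hb]
      nlinarith [mul_pos hL hb]
  refine ⟨1 / (8 * (4 + M) * (1 + L) ^ 2), by positivity, 1 / (8 * (1 + L) ^ 2), by positivity,
    1 / (8 * L ^ 2), by positivity, ?_⟩
  rintro α hα hα₀ T hT u hu ⟨R, hR, huR⟩ hu0 huL hpde hsmall t ht
  have hR' : 0 ≤ R + 1 := by linarith
  have htop : ((⊤ : ℕ∞) : WithTop ℕ∞) + 1 ≤ ((⊤ : ℕ∞) : WithTop ℕ∞) := le_rfl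
  have hn : ((⊤ : ℕ∞) : WithTop ℕ∞) ≠ 0 := by simp
  have sx := hu.Dx htop
  have sxx := sx.Dx htop
  have sy := hu.Dy htop
  have sxy := sy.Dx htop
  have st := hu.Dt htop
  have hA₁ : ContDiff ℝ 1 fun p : ℝ × ℝ × ℝ => a₁ p.2.1 p.2.2 :=
    ha₁.comp contDiff_snd
  have hA₂ : ContDiff ℝ 1 fun p : ℝ × ℝ × ℝ => a₂ p.2.1 p.2.2 :=
    ha₂.comp contDiff_snd
  have h01 : (0 : WithTop ℕ∞) + 1 ≤ 1 := by simp
  have dA₁ := hasDerivAt_Dx (u := fun _ => a₁) one_ne_zero hA₁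
  have dA₂ := hasDerivAt_Dy (u := fun _ => a₂) one_ne_zero hA₂
  have cA₁ := (ContDiff.Dx (u := fun _ => a₁) h01 hA₁).continuous
  have cA₂ := (ContDiff.Dy (u := fun _ => a₂) h01 hA₂).continuous
  have slice : ∀ {w : ℝ → ℝ → ℝ → ℝ}, (Continuous fun p : ℝ × ℝ × ℝ => w p.1 p.2.1 p.2.2) →
      ∀ s, Continuous fun p : ℝ × ℝ => w s p.1 p.2 := fun h s =>
    h.comp (continuous_const.prodMk continuous_id)
  have hout : ∀ t x y, R + 1 ≤ |x| → u t x y = 0 := fun t x y h => huR t x y (by linarith)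
  have houty : ∀ t x y, R + 1 ≤ |x| → Dy u t x y = 0 := fun t x y h => by
    have : (fun s => u t x s) = fun _ => 0 := funext fun s => hout t x s h
    rw [Dy, this, deriv_const]
  have houtx : ∀ t x y, R + 1 ≤ |x| → Dx u t x y = 0 := fun t x y h => by
    have : (fun s => u t s y) =ᶠ[nhds x] fun _ => 0 := by
      filter_upwards [continuous_abs.continuousAt.eventually_const_lt
        (show R < |x| by linarith)] with s hs using huR t s y hs.le
    rw [Dx, this.deriv_eq, deriv_const]
  have habs : |R + 1| = R + 1 := abs_of_nonneg hR'
  have habs' : |-(R + 1)| = R + 1 := by rw [abs_neg, habs]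
  have henergy := fun (γ : ℝ) (s : ℝ) (hs : s ∈ Icc 0 T) =>
    rectIntegral_energy_le (α := γ) (b := b) (M := M) hR' hL.le
      (slice hu.continuous s) (slice st.continuous s) (slice sx.continuous s)
      (slice sxx.continuous s) (slice (sxx.Dx htop).continuous s) (slice sy.continuous s)
      (slice (sy.Dy htop).continuous s) (slice sxy.continuous s)
      (slice (sxy.Dy htop).continuous s) (a₀ := a₀)
      ha₁.continuous (slice cA₁ s)
      ha₂.continuous (slice cA₂ s)
      (hasDerivAt_Dx hn hu s) (hasDerivAt_Dx hn sx s) (hasDerivAt_Dx hn sxx s)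
      (hasDerivAt_Dy hn hu s) (hasDerivAt_Dx hn sy s) (hasDerivAt_Dy hn sy s)
      (hasDerivAt_Dy hn sxy s) (dA₁ s)
      (dA₂ s) (fun x y => (le_abs_self _).trans (hM x y))
      ha₁0 ha₂0 ha₀0
      (fun x y hy => by
        have h := hpde s hs x y hy
        have h₁ : Dx (fun t x y => a₁ x y * Dx u t x y) s x y
            = Dx (fun _ => a₁) s x y * Dx u s x y + a₁ x y * Dx (Dx u) s x y :=
          ((dA₁ s x y).fun_mul (hasDerivAt_Dx hn sx s x y)).deriv
        have h₂ : Dy (fun t x y => a₂ x y * Dy u t x y) s x y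
            = Dy (fun _ => a₂) s x y * Dy u s x y + a₂ x y * Dy (Dy u) s x y :=
          ((dA₂ s x y).fun_mul (hasDerivAt_Dy hn sy s x y)).deriv
        rw [h₁, h₂, Dx_Dy_comm (contDiff_infty.1 sy 2)] at h
        exact h)
      (fun y => hout s _ y habs'.ge) (fun y => hout s _ y habs.ge)
      (fun y => houtx s _ y habs'.ge) (fun y => houtx s _ y habs.ge)
      (fun y => houty s _ y habs'.ge) (fun y => houty s _ y habs.ge)
      (hu0 s) (huL s)
  have hderiv := fun (γ s : ℝ) => hasDerivAt_rectIntegral (R := R + 1) (L := L)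
    (F := fun t x y => Real.exp (2 * γ * x) * u t x y ^ 2)
    (F' := fun t x y => Real.exp (2 * γ * x) * (2 * u t x y * Dt u t x y))
    (by have := hu.continuous; fun_prop)
    (by have := hu.continuous; have := st.continuous; fun_prop)
    (fun t x y => (((hasDerivAt_Dt hn hu t x y).fun_pow 2).const_mul _).congr_deriv (by simp)) s
  have hmass : ∀ s ∈ Icc 0 T, rectIntegral (R + 1) L (fun x y => u s x y ^ 2)
      ≤ (1 / (8 * (1 + L) ^ 2)) ^ 2 := fun s hs => by
    have h := le_exp_neg_mul_of_hasDerivAt_le (k := 0) (hderiv 0)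
      (fun s hs => by simpa using henergy 0 s hs) hs
    simp only [mul_zero, zero_mul, neg_zero, Real.exp_zero, one_mul] at h
    refine h.trans ?_
    rw [integral_integral_Ioo_eq_rectIntegral (R := R + 1) hL.le
      (fun x y hx => by simp [hout 0 x y hx]), ← Real.sqrt_eq_rpow] at hsmall
    exact (Real.sqrt_le_left (by positivity)).1 hsmall
  have hdecay : ∀ s ∈ Icc 0 T,
      rectIntegral (R + 1) L (fun x y => Real.exp (2 * α * x) * (2 * u s x y * Dt u s x y))
        ≤ -(2 * α * (1 / (8 * L ^ 2)))
          * rectIntegral (R + 1) L (fun x y => Real.exp (2 * α * x) * u s x y ^ 2) :=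
    fun s hs => (henergy α s hs).trans <| weighted_dissipation_le hL hb hM0 hα hα₀ rfl
      (rectIntegral_nonneg hR' hL.le fun x y _ => by positivity)
      (rectIntegral_nonneg hR' hL.le fun x y _ => by positivity)
      (rectIntegral_nonneg hR' hL.le fun x y _ => by positivity)
      (rectIntegral_sq_le hR' hL.le (slice hu.continuous s) (slice sy.continuous s)
        (hasDerivAt_Dy hn hu s) (hu0 s))
      (rectIntegral_cube_le hR' hL.le hα.le (by positivity) (slice hu.continuous s)
        (slice sx.continuous s) (slice sy.continuous s) (hasDerivAt_Dx hn hu s)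
        (hasDerivAt_Dy hn hu s) (hu0 s) (fun y => hout s _ y habs'.ge) (hmass s hs))
  rw [integral_integral_Ioo_eq_rectIntegral (R := R + 1) hL.le
      (fun x y hx => by simp [hout t x y hx]),
    integral_integral_Ioo_eq_rectIntegral (R := R + 1) hL.le
      (fun x y hx => by simp [hout 0 x y hx])]
  exact le_exp_neg_mul_of_hasDerivAt_le (hderiv α) hdecay ht
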